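/- Let n ≥ 1, let ι be a nonempty finite index set, let α : ι → ℝⁿ be a family of nonzero vectors and h : ι → ℝ, and set P = {u ∈ ℝⁿ : ⟨α_i, u⟩ ≤ h_i for all i ∈ ι}. Assume P is compact, 0 lies in the interior of P, and each inequality defines a facet, i.e. for every i ∈ ι there exists u with ⟨α_i, u⟩ = h_i and ⟨α_j, u⟩ < h_j for all j ≠ i. Then there exists a function φ : ℝⁿ → ℝ such that: (1) φ is C^∞; (2) φ is strictly convex and its Hessian is positive definite at every point (for every x and every v ≠ 0, the second derivative of φ at x in direction v is positive); (3) there is R > 0 with the closed ball of radius R about 0 contained in the interior of P and φ(t·x) = t² · φ(x) for all x with ‖x‖ ≥ R and all t ≥ 1; and (4) for every i ∈ ι and every u ∈ P with ⟨α_i, u⟩ = h_i, every point w ∈ P at which the linear functional p ↦ ⟨∇φ(u), p⟩ attains its maximum over P satisfies ⟨α_i, w⟩ = h_i. -/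

import Mathlib

open scoped RealInnerProductSpace

open Filter Topology Set

section Smoothing

variable {E : Type*} [NormedAddCommGroup E] [InnerProductSpace ℝ E]

/-- A sublinear function, smooth away from the origin for `ε ≠ 0`, which approximates
`x ↦ ⟪a, x⟫ + |⟪a, x⟫|` as `ε → 0`. -/
noncomputable def smoothPosPart (a : E) (ε : ℝ) (x : E) : ℝ :=
  ⟪a, x⟫ + √(⟪a, x⟫ ^ 2 + ε ^ 2 * ‖x‖ ^ 2) + ε * ‖x‖

theorem mul_norm_le_smoothPosPart (a : E) (ε : ℝ) (x : E) :
    ε * ‖x‖ ≤ smoothPosPart a ε x := by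
  have h1 : |⟪a, x⟫| ≤ √(⟪a, x⟫ ^ 2 + ε ^ 2 * ‖x‖ ^ 2) :=
    Real.abs_le_sqrt (by nlinarith [sq_nonneg (ε * ‖x‖)])
  have h2 := neg_abs_le ⟪a, x⟫
  unfold smoothPosPart
  linarith

theorem smoothPosPart_nonneg (a : E) {ε : ℝ} (hε : 0 ≤ ε) (x : E) : 0 ≤ smoothPosPart a ε x :=
  (by positivity : 0 ≤ ε * ‖x‖).trans (mul_norm_le_smoothPosPart a ε x)

theorem smoothPosPart_zero_left (a x : E) : smoothPosPart a 0 x = ⟪a, x⟫ + |⟪a, x⟫| := by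
  simp [smoothPosPart, Real.sqrt_sq_eq_abs]

theorem smoothPosPart_smul (a : E) (ε : ℝ) (x : E) {t : ℝ} (ht : 0 ≤ t) :
    smoothPosPart a ε (t • x) = t * smoothPosPart a ε x := by
  have h1 : (t * ⟪a, x⟫) ^ 2 + ε ^ 2 * (t * ‖x‖) ^ 2
      = t ^ 2 * (⟪a, x⟫ ^ 2 + ε ^ 2 * ‖x‖ ^ 2) := by ring
  simp only [smoothPosPart, inner_smul_right, norm_smul, Real.norm_of_nonneg ht]
  rw [h1, Real.sqrt_mul (sq_nonneg t), Real.sqrt_sq ht]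
  ring

theorem Real.sqrt_sq_add_sq_le_add (a b c d : ℝ) :
    √((a + c) ^ 2 + (b + d) ^ 2) ≤ √(a ^ 2 + b ^ 2) + √(c ^ 2 + d ^ 2) := by
  rw [Real.sqrt_le_left (by positivity)]
  have h1 := Real.sq_sqrt (by positivity : 0 ≤ a ^ 2 + b ^ 2)
  have h2 := Real.sq_sqrt (by positivity : 0 ≤ c ^ 2 + d ^ 2)
  have h3 : a * c + b * d ≤ √(a ^ 2 + b ^ 2) * √(c ^ 2 + d ^ 2) := by
    rw [← Real.sqrt_mul (by positivity)]
    exact Real.le_sqrt_of_sq_le (by nlinarith [sq_nonneg (a * d - b * c)])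
  nlinarith

theorem smoothPosPart_add_le (a : E) {ε : ℝ} (hε : 0 ≤ ε) (x y : E) :
    smoothPosPart a ε (x + y) ≤ smoothPosPart a ε x + smoothPosPart a ε y := by
  have h1 : ε * ‖x + y‖ ≤ ε * ‖x‖ + ε * ‖y‖ := by
    rw [← mul_add]
    exact mul_le_mul_of_nonneg_left (norm_add_le x y) hε
  have h2 : √((⟪a, x⟫ + ⟪a, y⟫) ^ 2 + (ε * ‖x + y‖) ^ 2)
      ≤ √((⟪a, x⟫ + ⟪a, y⟫) ^ 2 + (ε * ‖x‖ + ε * ‖y‖) ^ 2) := by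
    gcongr
  have h3 := Real.sqrt_sq_add_sq_le_add ⟪a, x⟫ (ε * ‖x‖) ⟪a, y⟫ (ε * ‖y‖)
  simp only [smoothPosPart, inner_add_right, ← mul_pow]
  linarith

theorem contDiffAt_smoothPosPart (a : E) {ε : ℝ} (hε : ε ≠ 0) {x : E} (hx : x ≠ 0) {k : ℕ∞} :
    ContDiffAt ℝ k (smoothPosPart a ε) x := by
  have h1 : ContDiffAt ℝ k (fun y : E => ⟪a, y⟫) x := contDiffAt_const.inner ℝ contDiffAt_id
  have h2 : ContDiffAt ℝ k (fun y : E => ‖y‖) x := contDiffAt_norm ℝ hx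
  have h3 : ⟪a, x⟫ ^ 2 + ε ^ 2 * ‖x‖ ^ 2 ≠ 0 := by
    have := norm_pos_iff.2 hx
    positivity
  exact (h1.add (((h1.pow 2).add (contDiffAt_const.mul (h2.pow 2))).sqrt h3)).add
    (contDiffAt_const.mul h2)

theorem continuous_smoothPosPart_uncurry (a : E) :
    Continuous fun z : ℝ × E => smoothPosPart a z.1 z.2 := by
  unfold smoothPosPart
  fun_prop

variable {ι : Type*} [Fintype ι]

/-- The `ℓᵖ` norm of the family of functions `smoothPosPart (a i) ε`. -/
noncomputable def smoothGauge (a : ι → E) (p ε : ℝ) (x : E) : ℝ :=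
  (∑ i, smoothPosPart (a i) ε x ^ p) ^ (1 / p)

theorem sum_smoothPosPart_rpow_nonneg (a : ι → E) (p : ℝ) {ε : ℝ} (hε : 0 ≤ ε) (x : E) :
    0 ≤ ∑ i, smoothPosPart (a i) ε x ^ p :=
  Finset.sum_nonneg fun i _ => Real.rpow_nonneg (smoothPosPart_nonneg (a i) hε x) p

theorem smoothGauge_nonneg (a : ι → E) (p : ℝ) {ε : ℝ} (hε : 0 ≤ ε) (x : E) :
    0 ≤ smoothGauge a p ε x :=
  Real.rpow_nonneg (sum_smoothPosPart_rpow_nonneg a p hε x) _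

theorem mul_norm_le_smoothGauge [Nonempty ι] (a : ι → E) {p ε : ℝ} (hp : 0 < p) (hε : 0 ≤ ε)
    (x : E) : ε * ‖x‖ ≤ smoothGauge a p ε x := by
  obtain ⟨i⟩ := ‹Nonempty ι›
  have h0 := smoothPosPart_nonneg (a i) hε x
  calc ε * ‖x‖ ≤ smoothPosPart (a i) ε x := mul_norm_le_smoothPosPart _ _ _
    _ = (smoothPosPart (a i) ε x ^ p) ^ (1 / p) := by
        rw [one_div, Real.rpow_rpow_inv h0 hp.ne']
    _ ≤ smoothGauge a p ε x := by
        refine Real.rpow_le_rpow (Real.rpow_nonneg h0 p) ?_ (by positivity)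
        exact Finset.single_le_sum (f := fun j => smoothPosPart (a j) ε x ^ p)
          (fun j _ => Real.rpow_nonneg (smoothPosPart_nonneg (a j) hε x) p) (Finset.mem_univ i)

theorem smoothGauge_smul (a : ι → E) {p ε : ℝ} (hp : 0 < p) (hε : 0 ≤ ε) (x : E) {t : ℝ}
    (ht : 0 ≤ t) : smoothGauge a p ε (t • x) = t * smoothGauge a p ε x := by
  simp only [smoothGauge, smoothPosPart_smul _ _ _ ht]
  simp only [Real.mul_rpow ht (smoothPosPart_nonneg _ hε x), ← Finset.mul_sum]
  rw [Real.mul_rpow (by positivity) (sum_smoothPosPart_rpow_nonneg a p hε x), one_div,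
    Real.rpow_rpow_inv ht hp.ne']

theorem smoothGauge_add_le (a : ι → E) {p ε : ℝ} (hp : 1 ≤ p) (hε : 0 ≤ ε) (x y : E) :
    smoothGauge a p ε (x + y) ≤ smoothGauge a p ε x + smoothGauge a p ε y := by
  refine le_trans ?_ (Real.Lp_add_le_of_nonneg Finset.univ hp
    (fun i _ => smoothPosPart_nonneg (a i) hε x) (fun i _ => smoothPosPart_nonneg (a i) hε y))
  refine Real.rpow_le_rpow (sum_smoothPosPart_rpow_nonneg a p hε _) ?_ (by positivity)
  exact Finset.sum_le_sum fun i _ => Real.rpow_le_rpow (smoothPosPart_nonneg (a i) hε _)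
    (smoothPosPart_add_le (a i) hε x y) (by linarith)

theorem convexOn_smoothGauge (a : ι → E) {p ε : ℝ} (hp : 1 ≤ p) (hε : 0 ≤ ε) :
    ConvexOn ℝ univ (smoothGauge a p ε) := by
  refine ⟨convex_univ, fun x _ y _ s t hs ht _ => ?_⟩
  have hp0 : 0 < p := by linarith
  simpa [smoothGauge_smul a hp0 hε _ hs, smoothGauge_smul a hp0 hε _ ht] using
    smoothGauge_add_le a hp hε (s • x) (t • y)

theorem contDiffAt_smoothGauge [Nonempty ι] (a : ι → E) {p ε : ℝ} (hε : 0 < ε)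
    {x : E} (hx : x ≠ 0) {k : ℕ∞} : ContDiffAt ℝ k (smoothGauge a p ε) x := by
  have hpos : ∀ i, 0 < smoothPosPart (a i) ε x := fun i =>
    (mul_pos hε (norm_pos_iff.2 hx)).trans_le (mul_norm_le_smoothPosPart (a i) ε x)
  have hsum : (∑ i, smoothPosPart (a i) ε x ^ p) ≠ 0 :=
    (Finset.sum_pos (fun i _ => Real.rpow_pos_of_pos (hpos i) p) Finset.univ_nonempty).ne'
  refine ContDiffAt.rpow_const_of_ne ?_ hsum
  exact ContDiffAt.sum fun i _ =>
    (contDiffAt_smoothPosPart (a i) hε.ne' hx).rpow_const_of_ne (hpos i).ne'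

theorem continuous_smoothGauge_uncurry (a : ι → E) {p : ℝ} (hp : 0 < p) :
    Continuous fun z : ℝ × E => smoothGauge a p z.1 z.2 := by
  refine Continuous.rpow_const ?_ fun _ => Or.inr (by positivity)
  exact continuous_finsetSum _ fun i _ =>
    (continuous_smoothPosPart_uncurry (a i)).rpow_const fun _ => Or.inr hp.le

end Smoothing

section Compactness

theorem IsCompact.eventually_forall_of_forall_eventually_prod {X Y : Type*} [TopologicalSpace Y]
    {l : Filter X} {K : Set Y} (hK : IsCompact K) {P : X → Y → Prop}
    (hP : ∀ y ∈ K, ∀ᶠ z : X × Y in l ×ˢ 𝓝 y, P z.1 z.2) :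
    ∀ᶠ x in l, ∀ y ∈ K, P x y := by
  simp only [← eventually_iSup, ← hK.prod_nhdsSet_eq_biSup] at hP
  exact hP.curry.mono fun _ h => h.self_of_nhdsSet

end Compactness

section Convex

variable {E : Type*} [NormedAddCommGroup E] [InnerProductSpace ℝ E]

theorem ConvexOn.sub_le_fderiv {f : E → ℝ} (hf : ConvexOn ℝ univ f) {u : E}
    (hd : DifferentiableAt ℝ f u) (d : E) : f u - f (u - d) ≤ fderiv ℝ f u d := by
  have hline : HasDerivAt (fun t : ℝ => u + t • d) d 0 := by
    simpa using ((hasDerivAt_id (0 : ℝ)).smul_const d).const_add u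
  have hconv : ConvexOn ℝ univ fun t : ℝ => f (u + t • d) := by
    have := hf.comp_affineMap (AffineMap.lineMap u (u + d) : ℝ →ᵃ[ℝ] E)
    simpa [Function.comp_def, AffineMap.lineMap_apply, add_comm] using this
  have hder : HasDerivAt (fun t : ℝ => f (u + t • d)) (fderiv ℝ f u d) 0 := by
    have h1 : HasFDerivAt f (fderiv ℝ f u) (u + (0 : ℝ) • d) := by simpa using hd.hasFDerivAt
    exact h1.comp_hasDerivAt (0 : ℝ) hline
  have := hconv.slope_le_of_hasDerivAt (mem_univ (-1)) (mem_univ 0) (by norm_num) hder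
  simpa [slope_def_field, sub_eq_add_neg] using this

theorem mul_norm_sq_le_iteratedFDeriv_two {f : E → ℝ} {m : ℝ} (hf : ContDiff ℝ 2 f)
    (hm : StrongConvexOn univ m f) (x v : E) :
    m * ‖v‖ ^ 2 ≤ iteratedFDeriv ℝ 2 f x ![v, v] := by
  have hline : ∀ t : ℝ, HasDerivAt (fun t : ℝ => x + t • v) v t := fun t => by
    simpa using ((hasDerivAt_id t).smul_const v).const_add x
  have hd1 : ∀ t : ℝ, HasDerivAt (fun t : ℝ => f (x + t • v)) (fderiv ℝ f (x + t • v) v) t :=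
    fun t => by
      have h1 : HasFDerivAt f (fderiv ℝ f (x + t • v)) (x + t • v) :=
        (hf.differentiable (by norm_num) _).hasFDerivAt
      exact h1.comp_hasDerivAt t (hline t)
  have hd2 : HasDerivAt (fun t : ℝ => fderiv ℝ f (x + t • v) v)
      (fderiv ℝ (fderiv ℝ f) x v v) 0 := by
    have h1 : HasFDerivAt (fderiv ℝ f) (fderiv ℝ (fderiv ℝ f) x) (x + (0 : ℝ) • v) := by
      simpa using ((hf.fderiv_right (m := 1) (by norm_num)).differentiable
        (by norm_num) x).hasFDerivAt
    have h2 : HasDerivAt (fun t : ℝ => fderiv ℝ f (x + t • v)) (fderiv ℝ (fderiv ℝ f) x v) 0 :=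
      h1.comp_hasDerivAt (0 : ℝ) (hline 0)
    simpa using h2.clm_apply (hasDerivAt_const (0 : ℝ) v)
  have hq : ∀ t : ℝ, HasDerivAt (fun t : ℝ => m / 2 * ‖x + t • v‖ ^ 2) (m * ⟪x + t • v, v⟫) t :=
    fun t => ((hline t).norm_sq.const_mul (m / 2)).congr_deriv (by ring)
  have hconv : ConvexOn ℝ univ fun t : ℝ => f (x + t • v) - m / 2 * ‖x + t • v‖ ^ 2 := by
    have := (strongConvexOn_iff_convex.1 hm).comp_affineMap
      (AffineMap.lineMap x (x + v) : ℝ →ᵃ[ℝ] E)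
    simpa [Function.comp_def, AffineMap.lineMap_apply, add_comm] using this
  have hder := fun t => (hd1 t).sub (hq t)
  have hmono : Monotone fun t : ℝ => fderiv ℝ f (x + t • v) v - m * ⟪x + t • v, v⟫ := by
    have h1 := hconv.monotoneOn_deriv fun t _ => (hder t).differentiableAt
    intro s t hst
    have h2 := h1 (mem_univ s) (mem_univ t) hst
    have h3 : ∀ t, deriv (fun t : ℝ => f (x + t • v) - m / 2 * ‖x + t • v‖ ^ 2) t = _ :=
      fun t => (hder t).deriv
    simpa only [h3] using h2
  have hd3 := hd2.sub (((hline 0).inner ℝ (hasDerivAt_const 0 v)).const_mul m)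
  have hnonneg := HasDerivAt.nonneg_of_monotone hd3 hmono
  rw [iteratedFDeriv_two_apply]
  simpa using hnonneg

end Convex

section Capping

/-- A smooth convex monotone modification of `s ↦ s ^ 2` that is constant near the origin. -/
theorem exists_smooth_convex_eq_sq {r : ℝ} (hr : 0 < r) :
    ∃ θ : ℝ → ℝ, ContDiff ℝ (⊤ : ℕ∞) θ ∧ ConvexOn ℝ univ θ ∧ Monotone θ ∧
      (∀ s, r ≤ s → θ s = s ^ 2) ∧ ∀ s, s ≤ r / 2 → θ s = θ 0 := by
  set g : ℝ → ℝ := fun s => 2 * s * Real.smoothTransition (2 * s / r - 1) with hg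
  have hgd : ContDiff ℝ (⊤ : ℕ∞) g :=
    (contDiff_const.mul contDiff_id).mul (Real.smoothTransition.contDiff.comp
      (((contDiff_const.mul contDiff_id).div_const r).sub contDiff_const))
  have hg0 : ∀ s, s ≤ r / 2 → g s = 0 := fun s hs => by
    have : 2 * s / r - 1 ≤ 0 := by
      rw [sub_nonpos, div_le_one hr]; linarith
    simp [hg, Real.smoothTransition.zero_of_nonpos this]
  have hg1 : ∀ s, r ≤ s → g s = 2 * s := fun s hs => by
    have : 1 ≤ 2 * s / r - 1 := by
      rw [le_sub_iff_add_le, le_div_iff₀ hr]; linarith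
    simp [hg, Real.smoothTransition.one_of_one_le this]
  have hgnn : ∀ s, 0 ≤ g s := fun s => by
    rcases le_total s (r / 2) with h | h
    · exact (hg0 s h).ge
    · have : 0 ≤ s := by linarith
      exact mul_nonneg (by linarith) (Real.smoothTransition.nonneg _)
  have hgm : Monotone g := fun s t hst => by
    rcases le_total s (r / 2) with h | h
    · rw [hg0 s h]; exact hgnn t
    · have : 0 ≤ s := by linarith
      refine mul_le_mul (by linarith) (Real.smoothTransition.monotone ?_)
        (Real.smoothTransition.nonneg _) (by linarith)
      gcongr
  have hint : ∀ s t, IntervalIntegrable g MeasureTheory.volume s t :=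
    fun s t => hgd.continuous.intervalIntegrable s t
  set θ : ℝ → ℝ := fun s => r ^ 2 + ∫ x in r..s, g x with hθ
  have hder : ∀ s, HasDerivAt θ (g s) s := fun s =>
    (intervalIntegral.integral_hasDerivAt_right (hint r s)
      (hgd.continuous.stronglyMeasurableAtFilter _ _) hgd.continuous.continuousAt).const_add _
  have hderiv : deriv θ = g := funext fun s => (hder s).deriv
  have hdiff : Differentiable ℝ θ := fun s => (hder s).differentiableAt
  refine ⟨θ, ?_, ?_, ?_, fun s hs => ?_, ?_⟩
  · exact contDiff_infty_iff_deriv.2 ⟨hdiff, hderiv ▸ hgd⟩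
  · exact Monotone.convexOn_univ_of_deriv hdiff (hderiv ▸ hgm)
  · exact monotone_of_deriv_nonneg hdiff fun s => by rw [hderiv]; exact hgnn s
  · have h1 : ∫ x in r..s, g x = ∫ x in r..s, 2 * x :=
      intervalIntegral.integral_congr fun x hx => hg1 x (by
        rw [uIcc_of_le hs] at hx; exact hx.1)
    have h2 : ∫ x in r..s, 2 * x = 2 * ∫ x in r..s, x := intervalIntegral.integral_const_mul 2 _
    rw [integral_id] at h2
    simp only [hθ, h1, h2]
    ring
  · have key : ∀ s, s ≤ r / 2 → θ s = θ (r / 2) := fun s hs => by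
      have h1 : ∫ x in s..(r / 2), g x = 0 := by
        rw [intervalIntegral.integral_congr (g := fun _ => (0 : ℝ))]
        · simp
        · intro x hx
          rw [uIcc_of_le hs] at hx
          exact hg0 x hx.2
      have h2 := intervalIntegral.integral_add_adjacent_intervals (hint r s) (hint s (r / 2))
      simp only [hθ]
      linarith
    intro s hs
    rw [key s hs, key 0 (by linarith)]

end Capping

section Polytope

variable {E : Type*} [NormedAddCommGroup E] [InnerProductSpace ℝ E] {ι : Type*} [Fintype ι]

/-- A polytope has a finite set of points (one in the relative interior of each face) that detects
whether a face of maximizers is contained in a given facet. -/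
theorem exists_finite_forall_exists_inner_le (a : ι → E) :
    ∃ X : Set E, X.Finite ∧ (∀ x ∈ X, ∀ j, ⟪a j, x⟫ ≤ 1) ∧
      ∀ y w : E, (∀ j, ⟪a j, w⟫ ≤ 1) → (∀ q, (∀ j, ⟪a j, q⟫ ≤ 1) → ⟪y, q⟫ ≤ ⟪y, w⟫) →
        ∀ i, ⟪a i, w⟫ < 1 → ∃ x ∈ X, ⟪a i, x⟫ < 1 ∧ ⟪y, w⟫ ≤ ⟪y, x⟫ := by
  obtain ⟨X, hXP, hX⟩ := exists_subset_bijOn {x : E | ∀ j, ⟪a j, x⟫ ≤ 1}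
    (fun x => {j | ⟪a j, x⟫ = 1})
  refine ⟨X, Set.Finite.of_finite_image (Set.toFinite _) hX.injOn, fun x hx => hXP hx, ?_⟩
  intro y w hw hmax i hi
  obtain ⟨x, hx, hxw⟩ := hX.surjOn (mem_image_of_mem _ hw)
  have hiff : ∀ j, ⟪a j, x⟫ = 1 ↔ ⟪a j, w⟫ = 1 := fun j => Set.ext_iff.1 hxw j
  refine ⟨x, hx, lt_of_le_of_ne (hXP hx i) fun h => hi.ne ((hiff i).1 h), ?_⟩
  have hev : ∀ᶠ τ : ℝ in 𝓝[>] 0, 0 < τ ∧ ∀ j, ⟪a j, w + τ • (w - x)⟫ ≤ 1 := by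
    refine eventually_mem_nhdsWithin.and (eventually_all.2 fun j => ?_)
    rcases (hw j).lt_or_eq with h | h
    · have hc : ContinuousAt (fun τ : ℝ => ⟪a j, w + τ • (w - x)⟫) 0 := by fun_prop
      have h' : ⟪a j, w + (0 : ℝ) • (w - x)⟫ < 1 := by simpa using h
      exact ((hc.eventually_lt continuousAt_const h').filter_mono nhdsWithin_le_nhds).mono
        fun _ => le_of_lt
    · refine Eventually.of_forall fun τ => ?_
      simp [inner_add_right, inner_smul_right, inner_sub_right, h, (hiff j).2 h]
  obtain ⟨τ, hτ, hτP⟩ := hev.exists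
  have := hmax _ hτP
  rw [inner_add_right, inner_smul_right, inner_sub_right] at this
  nlinarith

theorem eventually_sum_smoothPosPart_lt (a : ι → E) {u₀ x : E} (hu : ∀ j, ⟪a j, u₀⟫ ≤ 1)
    (hx : ∀ j, ⟪a j, x⟫ ≤ 1) {i : ι} (hix : ⟪a i, x⟫ < 1) :
    ∀ᶠ z : ℝ × E in atTop ×ˢ 𝓝 u₀, ⟪a i, z.2⟫ = 1 →
      ∑ j, smoothPosPart (a j) 0 (z.2 - (1 / 2 : ℝ) • (u₀ - x)) ^ z.1
        < ∑ j, smoothPosPart (a j) 0 z.2 ^ z.1 := by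
  classical
  set d : E := (1 / 2 : ℝ) • (u₀ - x) with hd
  have had : ∀ j, ⟪a j, d⟫ = (⟪a j, u₀⟫ - ⟪a j, x⟫) / 2 := fun j => by
    rw [hd, inner_smul_right, inner_sub_right]; ring
  obtain ⟨ρ, hρ0, hρ1, hρ⟩ : ∃ ρ : ℝ, 0 < ρ ∧ ρ < 1 ∧
      ∀ j, (j = i ∨ ⟪a j, u₀⟫ < 1) → ⟪a j, u₀ - d⟫ < ρ := by
    have hev : ∀ᶠ ρ : ℝ in 𝓝[<] 1, 0 < ρ ∧ ρ < 1 ∧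
        ∀ j, (j = i ∨ ⟪a j, u₀⟫ < 1) → ⟪a j, u₀ - d⟫ < ρ := by
      refine ((eventually_gt_nhds one_pos).filter_mono nhdsWithin_le_nhds).and
        (eventually_mem_nhdsWithin.and (eventually_all.2 fun j => ?_))
      by_cases hj : j = i ∨ ⟪a j, u₀⟫ < 1
      · have : ⟪a j, u₀ - d⟫ < 1 := by
          rw [inner_sub_right, had]
          rcases hj with rfl | hj
          · linarith [hu j]
          · linarith [hx j]
        exact ((eventually_gt_nhds this).filter_mono nhdsWithin_le_nhds).mono fun _ h _ => h
      · exact Eventually.of_forall fun _ h => absurd h hj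
    exact hev.exists
  have hp : ∀ᶠ p : ℝ in atTop, 1 ≤ p ∧ Fintype.card ι * ρ ^ p < 1 := by
    refine (eventually_ge_atTop 1).and ?_
    have := (tendsto_rpow_atTop_of_base_lt_one ρ (by linarith) hρ1).const_mul (Fintype.card ι : ℝ)
    rw [mul_zero] at this
    exact this.eventually_lt_const one_pos
  have hn : ∀ᶠ u in 𝓝 u₀, ∀ j, (j = i ∨ ⟪a j, u₀⟫ < 1) → ⟪a j, u - d⟫ < ρ := by
    refine eventually_all.2 fun j => ?_
    by_cases hj : j = i ∨ ⟪a j, u₀⟫ < 1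
    · have hc : ContinuousAt (fun u => ⟪a j, u - d⟫) u₀ := by fun_prop
      exact (hc.eventually_lt continuousAt_const (hρ j hj)).mono fun _ h _ => h
    · exact Eventually.of_forall fun _ h => absurd h hj
  filter_upwards [hp.prod_mk hn] with z hz hzi
  obtain ⟨p, u⟩ := z
  obtain ⟨⟨hp1, hpρ⟩, hud⟩ := hz
  dsimp only at *
  have hp0 : 0 ≤ p := by linarith
  set c : ι → ℝ := fun j =>
    if ⟪a j, u₀⟫ = 1 ∧ j ≠ i then smoothPosPart (a j) 0 u ^ p else 0 with hc
  have hle1 : ∀ j, smoothPosPart (a j) 0 (u - d) ^ p ≤ c j + (2 * ρ) ^ p := fun j => by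
    have hnn := smoothPosPart_nonneg (a j) le_rfl (u - d)
    have h2ρ : 0 ≤ (2 * ρ) ^ p := by positivity
    by_cases hj : ⟪a j, u₀⟫ = 1 ∧ j ≠ i
    · simp only [hc, if_pos hj]
      have : smoothPosPart (a j) 0 (u - d) ≤ smoothPosPart (a j) 0 u := by
        simp only [smoothPosPart_zero_left]
        have h1 : ⟪a j, u - d⟫ ≤ ⟪a j, u⟫ := by
          rw [inner_sub_right, had]
          linarith [hx j, hj.1]
        rcases abs_cases ⟪a j, u - d⟫ with h | h <;> rcases abs_cases ⟪a j, u⟫ with h' | h' <;>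
          linarith
      linarith [Real.rpow_le_rpow hnn this hp0]
    · simp only [hc, if_neg hj, zero_add]
      have hj' : j = i ∨ ⟪a j, u₀⟫ < 1 := by
        by_cases hji : j = i
        · exact Or.inl hji
        · exact Or.inr (lt_of_le_of_ne (hu j) fun h => hj ⟨h, hji⟩)
      refine Real.rpow_le_rpow hnn ?_ hp0
      have := hud j hj'
      rw [smoothPosPart_zero_left]
      rcases abs_cases ⟪a j, u - d⟫ with h | h <;> linarith
  have hle2 : ∀ j, c j + (if j = i then (2 : ℝ) ^ p else 0) ≤ smoothPosPart (a j) 0 u ^ p := by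
    intro j
    have hnn := Real.rpow_nonneg (smoothPosPart_nonneg (a j) le_rfl u) p
    by_cases hji : j = i
    · subst hji
      simp [hc, smoothPosPart_zero_left, hzi, one_add_one_eq_two]
    · by_cases hj : ⟪a j, u₀⟫ = 1 <;> simp [hc, hji, hj, hnn]
  have hs1 := Finset.sum_le_sum fun j (_ : j ∈ Finset.univ) => hle1 j
  have hs2 := Finset.sum_le_sum fun j (_ : j ∈ Finset.univ) => hle2 j
  rw [Finset.sum_add_distrib] at hs1 hs2
  rw [Finset.sum_const, Finset.card_univ, nsmul_eq_mul, Real.mul_rpow (by norm_num) hρ0.le] at hs1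
  rw [Finset.sum_ite_eq' Finset.univ i, if_pos (Finset.mem_univ i)] at hs2
  have h2p : (0 : ℝ) < 2 ^ p := by positivity
  nlinarith

/-- A convex function, homogeneous of degree two, which is smooth away from the origin. -/
noncomputable def smoothSqGauge (a : ι → E) (p ε : ℝ) (x : E) : ℝ :=
  smoothGauge a p ε x ^ 2 + ε * ‖x‖ ^ 2

theorem convexOn_smoothSqGauge (a : ι → E) {p ε : ℝ} (hp : 1 ≤ p) (hε : 0 ≤ ε) :
    ConvexOn ℝ univ (smoothSqGauge a p ε) :=
  ((convexOn_smoothGauge a hp hε).pow (fun x _ => smoothGauge_nonneg a p hε x) 2).add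
    ((convexOn_univ_norm.pow (fun x _ => norm_nonneg x) 2).smul hε)

theorem smoothSqGauge_smul (a : ι → E) {p ε : ℝ} (hp : 0 < p) (hε : 0 ≤ ε) (x : E) {t : ℝ}
    (ht : 0 ≤ t) : smoothSqGauge a p ε (t • x) = t ^ 2 * smoothSqGauge a p ε x := by
  simp only [smoothSqGauge, smoothGauge_smul a hp hε x ht, norm_smul, Real.norm_of_nonneg ht]
  ring

theorem exists_smoothSqGauge_sub_lt (a : ι → E) (hP : IsCompact {x : E | ∀ j, ⟪a j, x⟫ ≤ 1})
    {X : Set E} (hX : X.Finite) (hXP : ∀ x ∈ X, ∀ j, ⟪a j, x⟫ ≤ 1) :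
    ∃ p ε : ℝ, 1 ≤ p ∧ 0 < ε ∧ ∀ x ∈ X, ∀ i, ⟪a i, x⟫ < 1 →
      ∀ u ∈ {x : E | ∀ j, ⟪a j, x⟫ ≤ 1} ∩ {x | ⟪a i, x⟫ = 1},
        ∃ u₀, (∀ j, ⟪a j, u₀⟫ ≤ 1) ∧
          smoothSqGauge a p ε (u - (1 / 2 : ℝ) • (u₀ - x)) < smoothSqGauge a p ε u := by
  have hK : ∀ i, IsCompact ({x : E | ∀ j, ⟪a j, x⟫ ≤ 1} ∩ {x | ⟪a i, x⟫ = 1}) := fun i =>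
    hP.inter_right (isClosed_eq (by fun_prop) (by fun_prop))
  have h1 : ∀ᶠ p : ℝ in atTop, ∀ x ∈ X, ∀ i, ⟪a i, x⟫ < 1 →
      ∀ u ∈ {x : E | ∀ j, ⟪a j, x⟫ ≤ 1} ∩ {x | ⟪a i, x⟫ = 1},
        ∃ u₀, (∀ j, ⟪a j, u₀⟫ ≤ 1) ∧ (⟪a i, u⟫ = 1 →
          ∑ j, smoothPosPart (a j) 0 (u - (1 / 2 : ℝ) • (u₀ - x)) ^ p
            < ∑ j, smoothPosPart (a j) 0 u ^ p) := by
    refine (eventually_all_finite hX).2 fun x hx => eventually_all.2 fun i => ?_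
    by_cases hix : ⟪a i, x⟫ < 1
    · refine ((hK i).eventually_forall_of_forall_eventually_prod fun u₀ hu₀ => ?_).mono
        fun _ h _ => h
      exact (eventually_sum_smoothPosPart_lt a hu₀.1 (hXP x hx) hix).mono
        fun z hz => ⟨u₀, hu₀.1, hz⟩
    · exact Eventually.of_forall fun _ h => absurd h hix
  obtain ⟨p, hp, hp1⟩ := (h1.and (eventually_ge_atTop 1)).exists
  have hp0 : 0 < p := by linarith
  have hcont : Continuous fun z : ℝ × E => smoothSqGauge a p z.1 z.2 :=
    ((continuous_smoothGauge_uncurry a hp0).pow 2).add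
      (continuous_fst.mul (continuous_snd.norm.pow 2))
  have h2 : ∀ᶠ ε : ℝ in 𝓝 0, ∀ x ∈ X, ∀ i, ⟪a i, x⟫ < 1 →
      ∀ u ∈ {x : E | ∀ j, ⟪a j, x⟫ ≤ 1} ∩ {x | ⟪a i, x⟫ = 1},
        ∃ u₀, (∀ j, ⟪a j, u₀⟫ ≤ 1) ∧
          smoothSqGauge a p ε (u - (1 / 2 : ℝ) • (u₀ - x)) < smoothSqGauge a p ε u := by
    refine (eventually_all_finite hX).2 fun x hx => eventually_all.2 fun i => ?_
    by_cases hix : ⟪a i, x⟫ < 1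
    · refine ((hK i).eventually_forall_of_forall_eventually fun u hu => ?_).mono
        fun _ h _ => h
      obtain ⟨u₀, hu₀, hlt⟩ := hp x hx i hix u hu
      have h0 : smoothSqGauge a p 0 (u - (1 / 2 : ℝ) • (u₀ - x)) < smoothSqGauge a p 0 u := by
        have : smoothGauge a p 0 (u - (1 / 2 : ℝ) • (u₀ - x)) < smoothGauge a p 0 u :=
          Real.rpow_lt_rpow (sum_smoothPosPart_rpow_nonneg a p le_rfl _) (hlt hu.2)
            (by positivity)
        simpa [smoothSqGauge] using
          pow_lt_pow_left₀ this (smoothGauge_nonneg a p le_rfl _) two_ne_zero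
      have hsub : Continuous fun z : ℝ × E => (z.1, z.2 - (1 / 2 : ℝ) • (u₀ - x)) := by fun_prop
      have hopen := isOpen_lt (hcont.comp hsub) hcont
      filter_upwards [hopen.mem_nhds (x := ((0 : ℝ), u)) h0] with z hz
      exact ⟨u₀, hu₀, hz⟩
    · exact Eventually.of_forall fun _ h => absurd h hix
  obtain ⟨ε, hε, hε0⟩ := ((h2.filter_mono nhdsWithin_le_nhds).and
    (eventually_mem_nhdsWithin : ∀ᶠ ε : ℝ in 𝓝[>] 0, ε ∈ Ioi 0)).exists
  exact ⟨p, ε, hp1, hε0, hε⟩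

variable [Nonempty ι]

theorem differentiableAt_smoothSqGauge (a : ι → E) {p ε : ℝ} (hε : 0 < ε) {x : E} (hx : x ≠ 0) :
    DifferentiableAt ℝ (smoothSqGauge a p ε) x := by
  have h1 : DifferentiableAt ℝ (smoothGauge a p ε) x :=
    (contDiffAt_smoothGauge (k := 1) a hε hx).differentiableAt (by norm_num)
  have h2 : DifferentiableAt ℝ (fun y : E => ‖y‖ ^ 2) x :=
    (contDiff_norm_sq ℝ (n := 1)).differentiable (by norm_num) x
  exact (h1.pow 2).add (h2.const_mul ε)

theorem contDiff_comp_smoothGauge (a : ι → E) {p ε r : ℝ} (hp : 0 < p) (hε : 0 < ε) (hr : 0 < r)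
    {θ : ℝ → ℝ} {k : ℕ∞} (hθ : ContDiff ℝ k θ) (hθr : ∀ s, s ≤ r → θ s = θ 0) :
    ContDiff ℝ k fun x => θ (smoothGauge a p ε x) := by
  refine contDiff_iff_contDiffAt.2 fun x => ?_
  rcases eq_or_ne x 0 with rfl | hx
  · have hcont : Continuous fun y => smoothGauge a p ε y := by
      simpa only [Function.comp_def] using
        (continuous_smoothGauge_uncurry a hp).comp (Continuous.prodMk_right ε)
    have h0 : smoothGauge a p ε 0 < r := by
      have := smoothGauge_smul a hp hε.le 0 (le_refl (0 : ℝ))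
      rw [zero_smul, zero_mul] at this
      rwa [this]
    refine (contDiffAt_const (c := θ 0)).congr_of_eventuallyEq ?_
    filter_upwards [hcont.continuousAt.eventually_lt continuousAt_const h0] with y hy
    exact hθr _ hy.le
  · exact hθ.contDiffAt.comp x (contDiffAt_smoothGauge a hε hx)

end Polytope

/-- For a compact polytope `P = {u | ⟪α i, u⟫ ≤ h i}` in `ℝⁿ` containing `0`
in its interior and with each defining inequality giving a facet, there is a smooth strictly
convex function `φ` with everywhere positive definite Hessian, homogeneous of degree 2 outside
a compact subset of the interior of `P`, such that for every `u` on the facet defined by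
`α i`, any maximizer over `P` of the linear functional `⟪gradient φ u, ·⟫` also lies on that
facet. -/
theorem statement1 (n : ℕ) (hn : 1 ≤ n)
    (ι : Type) [Fintype ι] [Nonempty ι]
    (α : ι → EuclideanSpace ℝ (Fin n)) (hα : ∀ i, α i ≠ 0)
    (h : ι → ℝ)
    (P : Set (EuclideanSpace ℝ (Fin n)))
    (hP : P = {u : EuclideanSpace ℝ (Fin n) | ∀ i, ⟪α i, u⟫ ≤ h i})
    (hcomp : IsCompact P)
    (h0 : (0 : EuclideanSpace ℝ (Fin n)) ∈ interior P)
    (hfacet : ∀ i, ∃ u : EuclideanSpace ℝ (Fin n),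
      ⟪α i, u⟫ = h i ∧ ∀ j, j ≠ i → ⟪α j, u⟫ < h j) :
    ∃ φ : EuclideanSpace ℝ (Fin n) → ℝ,
      ContDiff ℝ (⊤ : ℕ∞) φ ∧
      (StrictConvexOn ℝ Set.univ φ ∧
        ∀ x v : EuclideanSpace ℝ (Fin n), v ≠ 0 →
          0 < iteratedFDeriv ℝ 2 φ x ![v, v]) ∧
      (∃ R > 0, Metric.closedBall (0 : EuclideanSpace ℝ (Fin n)) R ⊆ interior P ∧
        ∀ x : EuclideanSpace ℝ (Fin n), R ≤ ‖x‖ → ∀ t : ℝ, 1 ≤ t →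
          φ (t • x) = t ^ 2 * φ x) ∧
      (∀ i, ∀ u ∈ P, ⟪α i, u⟫ = h i →
        ∀ w ∈ P, (∀ p ∈ P, ⟪gradient φ u, p⟫ ≤ ⟪gradient φ u, w⟫) →
          ⟪α i, w⟫ = h i) := by
  have hpos : ∀ i, 0 < h i := fun i => by
    obtain ⟨r, hr, hball⟩ := Metric.mem_nhds_iff.1 (mem_interior_iff_mem_nhds.1 h0)
    have hnorm := norm_pos_iff.2 (hα i)
    have hmem : (r / 2 / ‖α i‖) • α i ∈ P := hball (by
      rw [mem_ball_zero_iff, norm_smul, Real.norm_of_nonneg (by positivity),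
        div_mul_cancel₀ _ hnorm.ne']
      linarith)
    rw [hP] at hmem
    have h1 := hmem i
    rw [inner_smul_right, real_inner_self_eq_norm_sq] at h1
    exact (by positivity : 0 < r / 2 / ‖α i‖ * ‖α i‖ ^ 2).trans_le h1
  set a : ι → EuclideanSpace ℝ (Fin n) := fun i => (h i)⁻¹ • α i with ha
  have hai : ∀ i x, ⟪a i, x⟫ = ⟪α i, x⟫ / h i := fun i x => by
    rw [ha, real_inner_smul_left, inv_mul_eq_div]
  have hle : ∀ i x, ⟪a i, x⟫ ≤ 1 ↔ ⟪α i, x⟫ ≤ h i := fun i x => by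
    rw [hai, div_le_one (hpos i)]
  have heq : ∀ i x, ⟪a i, x⟫ = 1 ↔ ⟪α i, x⟫ = h i := fun i x => by
    rw [hai, div_eq_one_iff_eq (hpos i).ne']
  have hPa : P = {x | ∀ j, ⟪a j, x⟫ ≤ 1} := by
    rw [hP]
    ext x
    simp only [mem_ofPred_eq, hle]
  obtain ⟨X, hXfin, hXP, hX⟩ := exists_finite_forall_exists_inner_le a
  obtain ⟨p, ε, hp1, hε, hlt⟩ := exists_smoothSqGauge_sub_lt a (hPa ▸ hcomp) hXfin hXP
  have hp0 : 0 < p := by linarith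
  obtain ⟨R, hR, hRP⟩ : ∃ R > 0,
      Metric.closedBall (0 : EuclideanSpace ℝ (Fin n)) R ⊆ interior P :=
    Metric.nhds_basis_closedBall.mem_iff.1 (isOpen_interior.mem_nhds h0)
  obtain ⟨θ, hθ, hθconv, hθmono, hθsq, hθ0⟩ := exists_smooth_convex_eq_sq (mul_pos hε hR)
  set φ : EuclideanSpace ℝ (Fin n) → ℝ := fun x => θ (smoothGauge a p ε x) + ε * ‖x‖ ^ 2 with hφ
  have hφeq : ∀ x, R ≤ ‖x‖ → φ x = smoothSqGauge a p ε x := fun x hx => by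
    have h1 : ε * R ≤ smoothGauge a p ε x :=
      (mul_le_mul_of_nonneg_left hx hε.le).trans (mul_norm_le_smoothGauge a hp0 hε.le x)
    simp only [hφ, smoothSqGauge, hθsq _ h1]
  have hφsmooth : ContDiff ℝ (⊤ : ℕ∞) φ :=
    (contDiff_comp_smoothGauge a hp0 hε (by positivity) hθ hθ0).add
      (contDiff_const.mul (contDiff_norm_sq ℝ))
  have hφconv : StrongConvexOn univ (2 * ε) φ := by
    rw [strongConvexOn_iff_convex]
    have hg := convexOn_smoothGauge a hp1 hε.le
    have h1 : (fun x => φ x - 2 * ε / 2 * ‖x‖ ^ 2) = fun x => θ (smoothGauge a p ε x) :=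
      funext fun x => by simp only [hφ]; ring
    rw [h1]
    refine ⟨convex_univ, fun x hx y hy s t hs ht hst => ?_⟩
    exact (hθmono (hg.2 hx hy hs ht hst)).trans
      (hθconv.2 (mem_univ _) (mem_univ _) hs ht hst)
  refine ⟨φ, hφsmooth, ⟨hφconv.strictConvexOn (by positivity), fun x v hv => ?_⟩,
    ⟨R, hR, hRP, fun x hx t ht => ?_⟩, fun i u hu hui w hw hmax => ?_⟩
  · have hv' := norm_pos_iff.2 hv
    exact (by positivity : 0 < 2 * ε * ‖v‖ ^ 2).trans_le
      (mul_norm_sq_le_iteratedFDeriv_two (contDiff_infty.1 hφsmooth 2) hφconv x v)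
  · have ht0 : 0 ≤ t := by linarith
    have htx : R ≤ ‖t • x‖ := by
      rw [norm_smul, Real.norm_of_nonneg ht0]
      nlinarith [norm_nonneg x]
    rw [hφeq _ htx, hφeq _ hx, smoothSqGauge_smul a hp0 hε.le x ht0]
  · have hRu : R < ‖u‖ := by
      by_contra! hle'
      have hint : u ∈ interior P := hRP (mem_closedBall_zero_iff.2 hle')
      have hc : ContinuousAt (fun t : ℝ => t • u) 1 := by fun_prop
      have hev : ∀ᶠ t : ℝ in 𝓝 1, t • u ∈ P :=
        hc.eventually (by simpa using mem_interior_iff_mem_nhds.1 hint)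
      obtain ⟨t, htP, ht⟩ := ((hev.filter_mono nhdsWithin_le_nhds).and
        (eventually_mem_nhdsWithin : ∀ᶠ t : ℝ in 𝓝[>] 1, t ∈ Ioi 1)).exists
      rw [hP] at htP
      have h1 := htP i
      rw [inner_smul_right, hui] at h1
      nlinarith [hpos i, mem_Ioi.1 ht]
    by_contra hwi
    rw [hPa] at hw hu hmax
    have hwi' : ⟪a i, w⟫ < 1 := lt_of_le_of_ne (hw i) fun h1 => hwi ((heq i w).1 h1)
    obtain ⟨x, hx, hix, hwx⟩ := hX (gradient φ u) w hw hmax i hwi'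
    obtain ⟨u₀, hu₀, hlt'⟩ := hlt x hx i hix u ⟨hu, (heq i u).2 hui⟩
    have hu0 : u ≠ 0 := norm_pos_iff.1 (hR.trans hRu)
    have hgrad := (convexOn_smoothSqGauge a hp1 hε.le).sub_le_fderiv
      (differentiableAt_smoothSqGauge a hε hu0) ((1 / 2 : ℝ) • (u₀ - x))
    have hnhds : φ =ᶠ[𝓝 u] smoothSqGauge a p ε := by
      filter_upwards [continuous_norm.continuousAt.eventually_const_lt hRu] with y hy
      exact hφeq y hy.le
    rw [← hnhds.fderiv_eq, ← inner_gradient_left, inner_smul_right, inner_sub_right] at hgrad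
    linarith [hmax u₀ hu₀]
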